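/- (Equivalence of the Robin and Dirichlet problems.) Let β and δ be real constants with β ≥ max(δ, −1−δ), set α = β − δ, and let k, a, h₀, γ, u_∞ > 0. Let ξ_R be the unique positive solution of (k·u_∞/(γ·2^{β+1}·a^{β+δ+2}))·f₁(z) = z^{β+δ+1}, where f₁(z) = 1/( (k/(2·a·h₀))·M(α/2 + 1/2, 1/2, z²) + z·M(α/2 + 1, 3/2, z²) ). Define u₀ = u_∞·ξ_R·M(−α/2 + 1/2, 3/2, −ξ_R²) / ( (k/(2·a·h₀))·M(−α/2, 1/2, −ξ_R²) + ξ_R·M(−α/2 + 1/2, 3/2, −ξ_R²) ). Then the unique positive solution ξ_D of the Dirichlet equation (k·u₀/(γ·2^{β+1}·a^{β+δ+2}))·f(z) = z^{β+δ+1}, with f(z) = 1/(z·M(α/2 + 1, 3/2, z²)), satisfies ξ_D = ξ_R. -/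

import Mathlib

/-- Kummer's confluent hypergeometric function
`M(a,b,z) = ∑ (a)_n / (b)_n · zⁿ/n!`, with `(a)_n` the rising factorial. -/
noncomputable def kummerM (a b z : ℝ) : ℝ :=
  ∑' n : ℕ, ((ascPochhammer ℝ n).eval a / (ascPochhammer ℝ n).eval b) * z ^ n / (n.factorial : ℝ)

open Filter Topology Finset

/-- The general term of the Kummer series. -/
noncomputable def kummerTerm (a b z : ℝ) (n : ℕ) : ℝ :=
  ((ascPochhammer ℝ n).eval a / (ascPochhammer ℝ n).eval b) * z ^ n / (n.factorial : ℝ)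

lemma kummerTerm_succ (a b z : ℝ) (n : ℕ) :
    kummerTerm a b z (n + 1) = (a + n) / (b + n) * (z / (n + 1)) * kummerTerm a b z n := by
  simp only [kummerTerm, ascPochhammer_succ_eval, Nat.factorial_succ, pow_succ, Nat.cast_mul,
    Nat.cast_succ, div_eq_mul_inv, mul_inv]
  ring

lemma tendsto_kummerTerm_ratio (a b z : ℝ) :
    Tendsto (fun n : ℕ => (a + n) / (b + n) * (z / (n + 1))) atTop (𝓝 0) := by
  have h := tendsto_add_mul_div_add_mul_atTop_nhds a b 1 (one_ne_zero : (1 : ℝ) ≠ 0)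
  have hz : Tendsto (fun n : ℕ => z / ((n : ℝ) + 1)) atTop (𝓝 0) :=
    tendsto_const_nhds.div_atTop
      (tendsto_atTop_add_const_right _ _ tendsto_natCast_atTop_atTop)
  simpa using h.mul hz

lemma summable_kummerTerm (a b z : ℝ) : Summable (kummerTerm a b z) := by
  refine summable_of_ratio_norm_eventually_le (r := 1 / 2) (by norm_num) ?_
  have h := (tendsto_kummerTerm_ratio a b z).norm
  rw [norm_zero] at h
  filter_upwards [h.eventually_le_const (by norm_num : (0 : ℝ) < 1 / 2)] with n hn
  rw [kummerTerm_succ, norm_mul]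
  gcongr

lemma ascPochhammer_succ_eval_left (n : ℕ) (a : ℝ) :
    (ascPochhammer ℝ (n + 1)).eval a = a * (ascPochhammer ℝ n).eval (a + 1) := by
  simp [ascPochhammer_succ_left, Polynomial.eval_comp]

lemma ascPochhammer_eval_ne_zero {b : ℝ} (hb : ∀ n : ℕ, b + n ≠ 0) (n : ℕ) :
    (ascPochhammer ℝ n).eval b ≠ 0 := by
  induction n with
  | zero => simp
  | succ n ih => rw [ascPochhammer_succ_eval]; exact mul_ne_zero ih (hb n)

lemma sum_choose_succ_mul_neg_one_pow (x : ℕ → ℝ) (n : ℕ) :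
    ∑ k ∈ range (n + 2), ((n + 1).choose k : ℝ) * (-1) ^ k * x k =
      ∑ k ∈ range (n + 1), (n.choose k : ℝ) * (-1) ^ k * (x k - x (k + 1)) := by
  have h : ∑ k ∈ range (n + 1), (n.choose (k + 1) : ℝ) * (-1) ^ (k + 1) * x (k + 1) + x 0 =
      ∑ k ∈ range (n + 1), (n.choose k : ℝ) * (-1) ^ k * x k := by
    rw [sum_range_succ, sum_range_succ' _ n]
    simp
  rw [sum_range_succ']
  simp only [mul_sub, sum_sub_distrib, ← h, Nat.choose_succ_succ, Nat.cast_add, add_mul,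
    sum_add_distrib, pow_succ]
  simp only [mul_neg, mul_one, neg_mul, sum_neg_distrib, Nat.choose_zero_right, Nat.cast_one,
    pow_zero, one_mul]
  ring

/-- The Chu–Vandermonde identity. -/
lemma sum_choose_mul_ascPochhammer_div (n : ℕ) (a b : ℝ) (hb : ∀ n : ℕ, b + n ≠ 0) :
    ∑ k ∈ range (n + 1), (n.choose k : ℝ) * (-1) ^ k *
        ((ascPochhammer ℝ k).eval (b - a) / (ascPochhammer ℝ k).eval b) =
      (ascPochhammer ℝ n).eval a / (ascPochhammer ℝ n).eval b := by
  induction n generalizing a b with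
  | zero => simp
  | succ n ih =>
    have hb' : ∀ n : ℕ, b + 1 + n ≠ 0 := fun m => by
      have := hb (m + 1)
      push_cast at this
      rwa [add_assoc, add_comm 1]
    have hb0 : b ≠ 0 := by simpa using hb 0
    rw [sum_choose_succ_mul_neg_one_pow, ascPochhammer_succ_eval_left,
      ascPochhammer_succ_eval_left, mul_div_mul_comm, ← ih (a + 1) (b + 1) hb', mul_sum]
    refine sum_congr rfl fun k _ => ?_
    have hk : (ascPochhammer ℝ k).eval b * (b + k) =
        b * (ascPochhammer ℝ k).eval (b + 1) := by
      rw [← ascPochhammer_succ_eval, ascPochhammer_succ_eval_left]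
    have h1 := ascPochhammer_eval_ne_zero hb k
    have h2 := ascPochhammer_eval_ne_zero hb' k
    have h3 := hb k
    have hdiff : (ascPochhammer ℝ k).eval (b - a) / (ascPochhammer ℝ k).eval b -
        (ascPochhammer ℝ (k + 1)).eval (b - a) / (ascPochhammer ℝ (k + 1)).eval b =
        a * (ascPochhammer ℝ k).eval (b - a) / (b * (ascPochhammer ℝ k).eval (b + 1)) := by
      rw [← hk, ascPochhammer_succ_eval, ascPochhammer_succ_eval]
      field_simp
      ring
    rw [hdiff, add_sub_add_right_eq_sub]
    field_simp

/-- Kummer's transformation. -/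
lemma kummerM_eq_exp_mul (a b z : ℝ) (hb : ∀ n : ℕ, b + n ≠ 0) :
    kummerM a b z = Real.exp z * kummerM (b - a) b (-z) := by
  have hexp : Real.exp z = ∑' n : ℕ, z ^ n / (n.factorial : ℝ) := by
    rw [Real.exp_eq_exp_ℝ, NormedSpace.exp_eq_tsum_div]
  change ∑' n, kummerTerm a b z n = Real.exp z * ∑' n, kummerTerm (b - a) b (-z) n
  rw [hexp, mul_comm, tsum_mul_tsum_eq_tsum_sum_range_of_summable_norm
    (summable_kummerTerm _ _ _).norm (Real.summable_pow_div_factorial z).norm]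
  refine tsum_congr fun n => ?_
  rw [kummerTerm, ← sum_choose_mul_ascPochhammer_div n a b hb, sum_mul, sum_div]
  refine sum_congr rfl fun k hk => ?_
  have hkn : k ≤ n := Nat.lt_succ_iff.mp (mem_range.mp hk)
  rw [kummerTerm, Nat.cast_choose ℝ hkn, neg_pow z, ← pow_mul_pow_sub z hkn]
  field_simp

lemma kummerTerm_nonneg {a b z : ℝ} (ha : 0 < a) (hb : 0 < b) (hz : 0 ≤ z) (n : ℕ) :
    0 ≤ kummerTerm a b z n := by
  have := ascPochhammer_pos n a ha
  have := ascPochhammer_pos n b hb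
  unfold kummerTerm
  positivity

lemma kummerM_pos {a b z : ℝ} (ha : 0 < a) (hb : 0 < b) (hz : 0 ≤ z) : 0 < kummerM a b z :=
  (summable_kummerTerm a b z).tsum_pos (kummerTerm_nonneg ha hb hz) 0 (by simp [kummerTerm])

lemma kummerM_monotoneOn {a b : ℝ} (ha : 0 < a) (hb : 0 < b) :
    MonotoneOn (kummerM a b) (Set.Ici 0) := by
  intro x (hx : 0 ≤ x) y _ hxy
  refine (summable_kummerTerm a b x).tsum_le_tsum (fun n => ?_) (summable_kummerTerm a b y)
  have := ascPochhammer_pos n a ha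
  have := ascPochhammer_pos n b hb
  gcongr

/-- Equivalence of the Robin and Dirichlet problems: if `ξ_R` is the positive root of the
Robin equation and `u₀` is defined from `h₀, u_∞` by the equivalence formula, then `ξ_R`
is the unique positive root of the Dirichlet equation, i.e. `ξ_D = ξ_R`. -/
theorem stmt16 (β δ k a h₀ γ uinf : ℝ) (hβ : β ≥ max δ (-1 - δ))
    (hk : 0 < k) (ha : 0 < a) (hh : 0 < h₀) (hγ : 0 < γ) (huinf : 0 < uinf)
    (α : ℝ) (hα : α = β - δ)
    (ξR : ℝ) (hξpos : 0 < ξR)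
    (hξ : (k * uinf / (γ * (2:ℝ) ^ (β + 1) * a ^ (β + δ + 2))) *
      (1 / ((k / (2 * a * h₀)) * kummerM (α/2 + 1/2) (1/2) (ξR^2) +
        ξR * kummerM (α/2 + 1) (3/2) (ξR^2))) = ξR ^ (β + δ + 1))
    (u₀ : ℝ)
    (hu₀ : u₀ = uinf * ξR * kummerM (-α/2 + 1/2) (3/2) (-ξR^2) /
      ((k / (2 * a * h₀)) * kummerM (-α/2) (1/2) (-ξR^2) +
        ξR * kummerM (-α/2 + 1/2) (3/2) (-ξR^2))) :
    ((k * u₀ / (γ * (2:ℝ) ^ (β + 1) * a ^ (β + δ + 2))) *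
      (1 / (ξR * kummerM (α/2 + 1) (3/2) (ξR^2))) = ξR ^ (β + δ + 1)) ∧
    (∀ z : ℝ, 0 < z →
      (k * u₀ / (γ * (2:ℝ) ^ (β + 1) * a ^ (β + δ + 2))) *
        (1 / (z * kummerM (α/2 + 1) (3/2) (z^2))) = z ^ (β + δ + 1) → z = ξR) := by
  obtain ⟨hβδ, hβδ'⟩ := max_le_iff.mp hβ
  have hα0 : 0 ≤ α := by linarith
  have hp : 0 ≤ β + δ + 1 := by linarith
  have hA : ∀ z : ℝ, 0 < kummerM (α/2 + 1) (3/2) (z^2) := fun z =>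
    kummerM_pos (by linarith) (by norm_num) (sq_nonneg z)
  have hB : 0 < kummerM (α/2 + 1/2) (1/2) (ξR^2) :=
    kummerM_pos (by linarith) (by norm_num) (sq_nonneg _)
  have hAe : kummerM (α/2 + 1) (3/2) (ξR^2) =
      Real.exp (ξR^2) * kummerM (-α/2 + 1/2) (3/2) (-ξR^2) := by
    rw [kummerM_eq_exp_mul _ _ _ fun n => by positivity]
    ring_nf
  have hBe : kummerM (α/2 + 1/2) (1/2) (ξR^2) =
      Real.exp (ξR^2) * kummerM (-α/2) (1/2) (-ξR^2) := by
    rw [kummerM_eq_exp_mul _ _ _ fun n => by positivity]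
    ring_nf
  have hu : u₀ = uinf * ξR * kummerM (α/2 + 1) (3/2) (ξR^2) /
      ((k / (2 * a * h₀)) * kummerM (α/2 + 1/2) (1/2) (ξR^2) +
        ξR * kummerM (α/2 + 1) (3/2) (ξR^2)) := by
    rw [hu₀, hAe, hBe, ← mul_div_mul_left _ _ (Real.exp_pos (ξR^2)).ne']
    ring_nf
  have hAR := hA ξR
  have hu₀pos : 0 < u₀ := by
    rw [hu]
    positivity
  have hroot : (k * u₀ / (γ * (2:ℝ) ^ (β + 1) * a ^ (β + δ + 2))) *
      (1 / (ξR * kummerM (α/2 + 1) (3/2) (ξR^2))) = ξR ^ (β + δ + 1) := by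
    rw [← hξ, hu]
    generalize kummerM (α/2 + 1) (3/2) (ξR^2) = A at hAR ⊢
    generalize kummerM (α/2 + 1/2) (1/2) (ξR^2) = B at hB ⊢
    field_simp
  have hanti : StrictAntiOn (fun z : ℝ => (k * u₀ / (γ * (2:ℝ) ^ (β + 1) * a ^ (β + δ + 2))) *
      (1 / (z * kummerM (α/2 + 1) (3/2) (z^2))) - z ^ (β + δ + 1)) (Set.Ioi 0) := by
    intro x (hx : 0 < x) y (hy : 0 < y) hxy
    have hmul : x * kummerM (α/2 + 1) (3/2) (x^2) < y * kummerM (α/2 + 1) (3/2) (y^2) :=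
      mul_lt_mul hxy (kummerM_monotoneOn (by linarith) (by norm_num) (sq_nonneg x) (sq_nonneg y)
        (by gcongr)) (hA x) hy.le
    have hxA : 0 < x * kummerM (α/2 + 1) (3/2) (x^2) := mul_pos hx (hA x)
    have hlt := mul_lt_mul_of_pos_left (one_div_lt_one_div_of_lt hxA hmul)
      (by positivity : 0 < k * u₀ / (γ * (2:ℝ) ^ (β + 1) * a ^ (β + δ + 2)))
    linarith [Real.rpow_le_rpow hx.le hxy.le hp]
  exact ⟨hroot, fun z hz hzroot => hanti.injOn hz hξpos (by simp only [hzroot, hroot, sub_self])⟩
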